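/- arXiv:1310.8342 — 2 statements merged into one kernel-verified Lean document; each statement's English description precedes it below -/
import Mathlib

section
/- Suppose in addition that φ is strictly convex. Let S*(κ) denote the optimum spectral efficiency for parameter κ ≥ 0. Then S*(κ) is strictly decreasing in κ: for 0 ≤ κ₁ < κ₂, S*(κ₂) < S*(κ₁). Moreover S*(κ) → 0 as κ → ∞, and S*(κ) → S₁ as κ → 0⁺, where S₁ > 0 is the unique solution of c·f(S₁) = Pc with f(S) = S·Φ'(S) − Φ(S). -/
open Set Filter

/-- For a strictly convex differentiable `g` on `[0,∞)`, the (negated) intercept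
`x g'(x) - g(x)` of the tangent line at `x` is strictly increasing in `x`. -/
theorem StrictConvexOn.strictMonoOn_mul_deriv_sub {g g' : ℝ → ℝ}
    (hg : StrictConvexOn ℝ (Ici 0) g)
    (hd : ∀ x ∈ Ici (0:ℝ), HasDerivWithinAt g (g' x) (Ici 0) x) :
    StrictMonoOn (fun x => x * g' x - g x) (Ici 0) := by
  intro a ha b hb hab
  have h1 : g' a < slope g a b := hg.lt_slope_of_hasDerivWithinAt ha hb hab (hd a ha)
  have h2 : slope g a b < g' b := hg.slope_lt_of_hasDerivWithinAt ha hb hab (hd b hb)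
  have h3 : 0 ≤ a * (g' b - g' a) := mul_nonneg ha (by linarith)
  rw [slope_def_field, div_lt_iff₀ (sub_pos.2 hab)] at h2
  dsimp only
  nlinarith

/-- At a minimizer `S > 0` of the average `P(x)/(W x)` over `x > 0`, the marginal and the
average value of `P` agree. -/
theorem mul_deriv_eq_of_forall_div_le {P : ℝ → ℝ} {P' W S : ℝ} (hW : 0 < W) (hS : 0 < S)
    (hP : HasDerivAt P P' S) (hmin : ∀ T, 0 < T → P S / (W * S) ≤ P T / (W * T)) :
    S * P' = P S := by
  have hloc : IsLocalMin (fun x => P x / (W * x)) S := by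
    filter_upwards [Ioi_mem_nhds hS] with T hT using hmin T hT
  have hlin : HasDerivAt (fun x => W * x) W S := by
    simpa using (hasDerivAt_id S).const_mul W
  have hWS : W * S ≠ 0 := (mul_pos hW hS).ne'
  have h := hloc.hasDerivAt_eq_zero (hP.div hlin hWS)
  rw [div_eq_zero_iff, or_iff_left (pow_ne_zero 2 hWS)] at h
  have : W * (S * P' - P S) = 0 := by linarith
  rcases mul_eq_zero.1 this with h0 | h0
  · exact absurd h0 hW.ne'
  · linarith

/-- Suppose the rate-dependent circuit-power function `φ` is strictly convex, and let
`S*(κ)` be the optimum spectral efficiency (the unique minimizer over `S > 0` of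
`E_κ(S) = (κ·φ(W·S) + c·Φ(S) + Pc)/(W·S)`) for each `κ ≥ 0`.  Then `S*` is strictly
decreasing in `κ` on `[0,∞)`, `S*(κ) → 0` as `κ → ∞`, and `S*(κ) → S₁` as `κ → 0⁺`,
where `S₁ > 0` is the (unique) solution of `c·f(S₁) = Pc` with `f(S) = S·Φ'(S) − Φ(S)`. -/
theorem stmt_11 (W c Pc : ℝ) (hW : 0 < W) (hc : 0 < c) (hPc : 0 < Pc)
    (φ φ' Φ Φ' : ℝ → ℝ)
    (hφd : ∀ R ∈ Ici (0:ℝ), HasDerivWithinAt φ (φ' R) (Ici 0) R)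
    (hφm : StrictMonoOn φ (Ici 0)) (hφc : StrictConvexOn ℝ (Ici 0) φ) (hφ0 : φ 0 = 0)
    (hΦd : ∀ S ∈ Ici (0:ℝ), HasDerivWithinAt Φ (Φ' S) (Ici 0) S)
    (hΦm : StrictMonoOn Φ (Ici 0)) (hΦc : StrictConvexOn ℝ (Ici 0) Φ) (hΦ0 : Φ 0 = 0)
    (hΦinf : Tendsto (fun S => Φ S / S) atTop atTop)
    (Sstar : ℝ → ℝ)
    (hS : ∀ κ : ℝ, 0 ≤ κ → 0 < Sstar κ ∧
      (∀ T : ℝ, 0 < T →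
        (κ * φ (W * Sstar κ) + c * Φ (Sstar κ) + Pc) / (W * Sstar κ)
          ≤ (κ * φ (W * T) + c * Φ T + Pc) / (W * T)) ∧
      (∀ S' : ℝ, 0 < S' →
        (∀ T : ℝ, 0 < T →
          (κ * φ (W * S') + c * Φ S' + Pc) / (W * S')
            ≤ (κ * φ (W * T) + c * Φ T + Pc) / (W * T)) → S' = Sstar κ))
    (S₁ : ℝ) (hS₁pos : 0 < S₁) (hS₁ : c * (S₁ * Φ' S₁ - Φ S₁) = Pc) :
    StrictAntiOn Sstar (Ici 0) ∧
    Tendsto Sstar atTop (nhds 0) ∧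
    Tendsto Sstar (nhdsWithin 0 (Ioi 0)) (nhds S₁) := by
  set A : ℝ → ℝ := fun x => W * x * φ' (W * x) - φ (W * x) with hA
  set B : ℝ → ℝ := fun x => c * (x * Φ' x - Φ x) with hB
  have hA_mono : StrictMonoOn A (Ici 0) := fun a ha b hb hab =>
    hφc.strictMonoOn_mul_deriv_sub hφd (mul_nonneg hW.le ha) (mul_nonneg hW.le hb)
      (mul_lt_mul_of_pos_left hab hW)
  have hB_mono : StrictMonoOn B (Ici 0) := fun a ha b hb hab =>
    mul_lt_mul_of_pos_left (hΦc.strictMonoOn_mul_deriv_sub hΦd ha hb hab) hc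
  have hA_pos : ∀ x, 0 < x → 0 < A x := fun x hx => by
    simpa [hA, hφ0] using hA_mono self_mem_Ici hx.le hx
  have hB_pos : ∀ x, 0 < x → 0 < B x := fun x hx => by
    simpa [hB, hΦ0] using hB_mono self_mem_Ici hx.le hx
  have hpos : ∀ κ, 0 ≤ κ → 0 < Sstar κ := fun κ hκ => (hS κ hκ).1
  have hopt : ∀ κ, 0 ≤ κ → κ * A (Sstar κ) + B (Sstar κ) = Pc := by
    intro κ hκ
    have hs := hpos κ hκ
    have hWs := mul_pos hW hs
    have hdφ : HasDerivAt φ (φ' (W * Sstar κ)) (W * Sstar κ) :=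
      (hφd _ hWs.le).hasDerivAt (Ici_mem_nhds hWs)
    have hdΦ : HasDerivAt Φ (Φ' (Sstar κ)) (Sstar κ) :=
      (hΦd _ hs.le).hasDerivAt (Ici_mem_nhds hs)
    have hlin : HasDerivAt (fun x => W * x) W (Sstar κ) := by
      simpa using (hasDerivAt_id (Sstar κ)).const_mul W
    have h := mul_deriv_eq_of_forall_div_le
      (P := fun x => κ * φ (W * x) + c * Φ x + Pc) hW hs
      ((((hdφ.comp (Sstar κ) hlin).const_mul κ).add (hdΦ.const_mul c)).add_const Pc)
      (hS κ hκ).2.1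
    simp only [hA, hB]
    linear_combination h
  have hanti : StrictAntiOn Sstar (Ici 0) := by
    intro κ₁ h₁ κ₂ h₂ h
    by_contra! hle
    have hA_le := hA_mono.monotoneOn (hpos κ₁ h₁).le (hpos κ₂ h₂).le hle
    have hB_le := hB_mono.monotoneOn (hpos κ₁ h₁).le (hpos κ₂ h₂).le hle
    have e₁ := hopt κ₁ h₁
    have e₂ := hopt κ₂ h₂
    have hm₁ := mul_le_mul_of_nonneg_left hA_le (mem_Ici.1 h₁)
    have hm₂ := mul_lt_mul_of_pos_right h (hA_pos _ (hpos κ₂ h₂))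
    linarith
  have hzero : Sstar 0 = S₁ :=
    hB_mono.injOn (hpos 0 le_rfl).le hS₁pos.le (by simpa [hB, hS₁] using hopt 0 le_rfl)
  refine ⟨hanti, ?_, ?_⟩
  · rw [tendsto_order]
    constructor
    · intro a ha
      filter_upwards [eventually_ge_atTop 0] with κ hκ using ha.trans (hpos κ hκ)
    · intro ε hε
      filter_upwards [eventually_ge_atTop 0, eventually_gt_atTop (Pc / A ε)] with κ hκ hκε
      by_contra! hle
      rw [div_lt_iff₀ (hA_pos ε hε)] at hκε
      have hm := mul_le_mul_of_nonneg_left (hA_mono.monotoneOn hε.le (hpos κ hκ).le hle) hκ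
      have := hopt κ hκ
      have := hB_pos _ (hpos κ hκ)
      linarith
  · rw [tendsto_order]
    constructor
    · intro a ha
      obtain ⟨s, hs, hs₁⟩ := exists_between (max_lt ha hS₁pos)
      have hs0 : 0 < s := (le_max_right _ _).trans_lt hs
      have hBs : B s < Pc := (hB_mono hs0.le hS₁pos.le hs₁).trans_eq hS₁
      have hδ : 0 < (Pc - B s) / A s := div_pos (sub_pos.2 hBs) (hA_pos s hs0)
      filter_upwards [Ioo_mem_nhdsGT hδ] with κ hκ
      refine ((le_max_left _ _).trans_lt hs).trans ?_
      by_contra! hle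
      have hκ0 : 0 ≤ κ := hκ.1.le
      have hκs := (lt_div_iff₀ (hA_pos s hs0)).1 hκ.2
      have hm := mul_le_mul_of_nonneg_left (hA_mono.monotoneOn (hpos κ hκ0).le hs0.le hle) hκ0
      have := hB_mono.monotoneOn (hpos κ hκ0).le hs0.le hle
      have := hopt κ hκ0
      linarith
    · intro a ha
      filter_upwards [self_mem_nhdsWithin] with κ hκ
      exact (hanti self_mem_Ici (mem_Ici.2 (mem_Ioi.1 hκ).le) hκ).trans_le (hzero.le.trans ha.le)
end

section
/- For every S > 0, the function Φ₂ is differentiable at S and Φ₂'(S) = ln 2 / ∫ (g/(1 + g·p*)) dμ(g), where p* = Φ₂(S) is the unique p ≥ 0 with ∫ log₂(1 + g·p) dμ(g) = S. -/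
open MeasureTheory Real Set

/-- The minimum transmission-power-to-noise ratio achieving spectral efficiency `S`
for a fast-varying channel with channel distribution information at the transmitter. -/
noncomputable def Phi2 (μ : Measure ℝ) (S : ℝ) : ℝ :=
  sInf {p : ℝ | 0 ≤ p ∧ S ≤ ∫ g, logb 2 (1 + g * p) ∂μ}

lemma logb_two_one_add_nonneg {x : ℝ} (hx : 0 ≤ x) : 0 ≤ logb 2 (1 + x) :=
  logb_nonneg one_lt_two (by linarith)

lemma logb_two_one_add_le {x : ℝ} (hx : 0 ≤ x) : logb 2 (1 + x) ≤ x / log 2 := by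
  rw [logb]
  have := log_le_sub_one_of_pos (show 0 < 1 + x by linarith)
  have := log_pos one_lt_two
  gcongr
  linarith

lemma ae_pos_of_measure_Iic_zero {μ : Measure ℝ} (hsupp : μ (Iic 0) = 0) : ∀ᵐ g ∂μ, 0 < g := by
  rw [ae_iff]
  simpa [Iic] using hsupp

lemma integral_pos_of_ae_pos {α : Type*} [MeasurableSpace α] {μ : Measure α} [NeZero μ]
    {f : α → ℝ} (hf : ∀ᵐ x ∂μ, 0 < f x) (hi : Integrable f μ) : 0 < ∫ x, f x ∂μ := by
  refine (integral_nonneg_of_ae (hf.mono fun x hx => hx.le)).lt_of_ne' fun h => ?_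
  have h0 := (integral_eq_zero_iff_of_nonneg_ae (hf.mono fun x hx => hx.le) hi).1 h
  obtain ⟨x, hx, hx0⟩ := (hf.and h0).exists
  exact hx.ne' hx0

section Capacity

variable {μ : Measure ℝ}

lemma integrable_logb_one_add_mul (hsupp : μ (Iic 0) = 0) (hmean : Integrable id μ)
    {p : ℝ} (hp : 0 ≤ p) : Integrable (fun g => logb 2 (1 + g * p)) μ := by
  refine ((hmean.mul_const p).div_const (log 2)).mono'
    (Measurable.aestronglyMeasurable (by unfold logb; fun_prop)) ?_
  filter_upwards [ae_pos_of_measure_Iic_zero hsupp] with g hg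
  have hgp : 0 ≤ g * p := by positivity
  rw [norm_of_nonneg (logb_two_one_add_nonneg hgp)]
  exact logb_two_one_add_le hgp

lemma integral_logb_one_add_mul_le (hsupp : μ (Iic 0) = 0) (hmean : Integrable id μ)
    {p : ℝ} (hp : 0 ≤ p) :
    ∫ g, logb 2 (1 + g * p) ∂μ ≤ (∫ g, g ∂μ) * p / log 2 := by
  rw [← integral_mul_const, ← integral_div]
  refine integral_mono_ae (integrable_logb_one_add_mul hsupp hmean hp)
    ((hmean.mul_const p).div_const (log 2)) ?_
  filter_upwards [ae_pos_of_measure_Iic_zero hsupp] with g hg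
  exact logb_two_one_add_le (by positivity)

lemma strictMonoOn_integral_logb_one_add_mul [NeZero μ] (hsupp : μ (Iic 0) = 0)
    (hmean : Integrable id μ) :
    StrictMonoOn (fun p => ∫ g, logb 2 (1 + g * p) ∂μ) (Ici 0) := by
  intro p hp q hq hpq
  rw [mem_Ici] at hp hq
  have hip := integrable_logb_one_add_mul hsupp hmean hp
  have hiq := integrable_logb_one_add_mul hsupp hmean hq
  refine sub_pos.1 ?_
  rw [← integral_sub hiq hip]
  refine integral_pos_of_ae_pos ?_ (hiq.sub hip)
  filter_upwards [ae_pos_of_measure_Iic_zero hsupp] with g hg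
  exact sub_pos.2 (logb_lt_logb one_lt_two (by positivity) (by gcongr))

lemma integrable_div_one_add_mul (hsupp : μ (Iic 0) = 0) (hmean : Integrable id μ)
    {p : ℝ} (hp : 0 ≤ p) : Integrable (fun g => g / (1 + g * p)) μ := by
  refine hmean.mono' (Measurable.aestronglyMeasurable (by fun_prop)) ?_
  filter_upwards [ae_pos_of_measure_Iic_zero hsupp] with g hg
  rw [norm_of_nonneg (by positivity)]
  exact div_le_self hg.le (le_add_of_nonneg_right (by positivity))

lemma hasDerivAt_integral_logb_one_add_mul (hsupp : μ (Iic 0) = 0) (hmean : Integrable id μ)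
    {p : ℝ} (hp : 0 < p) :
    HasDerivAt (fun p => ∫ g, logb 2 (1 + g * p) ∂μ)
      ((∫ g, g / (1 + g * p) ∂μ) / log 2) p := by
  rw [← integral_div]
  refine (hasDerivAt_integral_of_dominated_loc_of_deriv_le (Ioi_mem_nhds hp)
    (F := fun p g => logb 2 (1 + g * p)) (F' := fun p g => g / (1 + g * p) / log 2)
    (bound := fun g => g / log 2)
    (.of_forall fun q => Measurable.aestronglyMeasurable (by unfold logb; fun_prop))
    (integrable_logb_one_add_mul hsupp hmean hp.le)
    (Measurable.aestronglyMeasurable (by fun_prop)) ?_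
    (hmean.div_const (log 2)) ?_).2
  · filter_upwards [ae_pos_of_measure_Iic_zero hsupp] with g hg q hq
    rw [mem_Ioi] at hq
    have := log_pos one_lt_two
    rw [norm_of_nonneg (by positivity)]
    gcongr
    exact div_le_self hg.le (le_add_of_nonneg_right (by positivity))
  · filter_upwards [ae_pos_of_measure_Iic_zero hsupp] with g hg q hq
    rw [mem_Ioi] at hq
    have h : HasDerivAt (fun q => 1 + g * q) g q := by
      simpa using ((hasDerivAt_id q).const_mul g).const_add 1
    exact (h.log (by positivity)).div_const (log 2)

lemma exists_measure_Ici_pos [NeZero μ] (hsupp : μ (Iic 0) = 0) : ∃ ε > 0, 0 < μ (Ici ε) := by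
  by_contra! h
  have hall : ∀ᵐ g ∂μ, ∀ n : ℕ, g < 1 / ((n : ℝ) + 1) := by
    refine ae_all_iff.2 fun n => ?_
    rw [ae_iff]
    simpa [Ici] using h (1 / ((n : ℝ) + 1)) (by positivity)
  obtain ⟨g, hg, hlt⟩ := ((ae_pos_of_measure_Iic_zero hsupp).and hall).exists
  obtain ⟨n, hn⟩ := exists_nat_one_div_lt hg
  exact (hlt n).not_gt hn

lemma exists_le_integral_logb_one_add_mul [IsFiniteMeasure μ] [NeZero μ] (hsupp : μ (Iic 0) = 0)
    (hmean : Integrable id μ) (S : ℝ) : ∃ p > 0, S ≤ ∫ g, logb 2 (1 + g * p) ∂μ := by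
  obtain ⟨ε, hε, hμ⟩ := exists_measure_Ici_pos hsupp
  have hm : 0 < μ.real (Ici ε) := ENNReal.toReal_pos hμ.ne' (measure_ne_top _ _)
  have hlim : Filter.Tendsto (fun p => logb 2 (1 + ε * p) * μ.real (Ici ε))
      Filter.atTop Filter.atTop :=
    ((tendsto_logb_atTop one_lt_two).comp (Filter.tendsto_atTop_add_const_left _ 1
      (Filter.tendsto_id.const_mul_atTop hε))).atTop_mul_const hm
  obtain ⟨p, hSp, hp⟩ := ((hlim.eventually_ge_atTop S).and (Filter.eventually_gt_atTop 0)).exists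
  have hnonneg : 0 ≤ᵐ[μ] fun g => logb 2 (1 + g * p) := by
    filter_upwards [ae_pos_of_measure_Iic_zero hsupp] with g hg
    exact logb_two_one_add_nonneg (by positivity)
  refine ⟨p, hp, hSp.trans (le_trans ?_ (mul_meas_ge_le_integral_of_nonneg hnonneg
    (integrable_logb_one_add_mul hsupp hmean hp.le) (logb 2 (1 + ε * p))))⟩
  refine mul_le_mul_of_nonneg_left (measureReal_mono fun g hg => ?_)
    (logb_two_one_add_nonneg (by positivity))
  rw [mem_Ici] at hg
  exact logb_le_logb_of_le one_lt_two (by positivity) (by gcongr)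

lemma exists_integral_logb_one_add_mul_eq [IsFiniteMeasure μ] [NeZero μ] (hsupp : μ (Iic 0) = 0)
    (hmean : Integrable id μ) {S : ℝ} (hS : 0 < S) :
    ∃ p > 0, ∫ g, logb 2 (1 + g * p) ∂μ = S := by
  obtain ⟨b, hb, hSb⟩ := exists_le_integral_logb_one_add_mul hsupp hmean S
  have hM : 0 < ∫ g, g ∂μ := integral_pos_of_ae_pos (ae_pos_of_measure_Iic_zero hsupp) hmean
  have hlog := log_pos one_lt_two
  set a := S * log 2 / ∫ g, g ∂μ with ha_def
  have ha : 0 < a := by positivity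
  have haS : ∫ g, logb 2 (1 + g * a) ∂μ ≤ S := by
    refine (integral_logb_one_add_mul_le hsupp hmean ha.le).trans_eq ?_
    rw [ha_def]
    field_simp
  have hab : a ≤ b := (strictMonoOn_integral_logb_one_add_mul hsupp hmean).le_iff_le
    ha.le hb.le |>.1 (haS.trans hSb)
  obtain ⟨p, hp, hpS⟩ := intermediate_value_Icc hab (fun q hq =>
    (hasDerivAt_integral_logb_one_add_mul hsupp hmean
      (ha.trans_le hq.1)).continuousAt.continuousWithinAt) ⟨haS, hSb⟩
  exact ⟨p, ha.trans_le hp.1, hpS⟩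

lemma Phi2_integral_logb_one_add_mul [NeZero μ] (hsupp : μ (Iic 0) = 0)
    (hmean : Integrable id μ) {p : ℝ} (hp : 0 ≤ p) :
    Phi2 μ (∫ g, logb 2 (1 + g * p) ∂μ) = p := by
  have h : {q : ℝ | 0 ≤ q ∧ ∫ g, logb 2 (1 + g * p) ∂μ ≤ ∫ g, logb 2 (1 + g * q) ∂μ} = Ici p := by
    ext q
    have hmono := strictMonoOn_integral_logb_one_add_mul hsupp hmean
    exact ⟨fun hq => (hmono.le_iff_le hp hq.1).1 hq.2,
      fun hq => ⟨hp.trans hq, (hmono.le_iff_le hp (hp.trans hq)).2 hq⟩⟩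
  rw [Phi2, h, csInf_Ici]

lemma Phi2_pos_and_integral_eq [IsFiniteMeasure μ] [NeZero μ] (hsupp : μ (Iic 0) = 0)
    (hmean : Integrable id μ) {S : ℝ} (hS : 0 < S) :
    0 < Phi2 μ S ∧ ∫ g, logb 2 (1 + g * Phi2 μ S) ∂μ = S := by
  obtain ⟨p, hp, rfl⟩ := exists_integral_logb_one_add_mul_eq hsupp hmean hS
  rw [Phi2_integral_logb_one_add_mul hsupp hmean hp.le]
  exact ⟨hp, rfl⟩

lemma continuousAt_Phi2 [IsFiniteMeasure μ] [NeZero μ] (hsupp : μ (Iic 0) = 0)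
    (hmean : Integrable id μ) {S : ℝ} (hS : 0 < S) : ContinuousAt (Phi2 μ) S := by
  have hmono := strictMonoOn_integral_logb_one_add_mul hsupp hmean
  refine continuousAt_of_monotoneOn_of_image_mem_nhds (s := Ioi 0) ?_ (Ioi_mem_nhds hS) ?_
  · intro S hS T hT hST
    obtain ⟨hp, hpS⟩ := Phi2_pos_and_integral_eq hsupp hmean hS
    obtain ⟨hq, hqT⟩ := Phi2_pos_and_integral_eq hsupp hmean hT
    exact (hmono.le_iff_le hp.le hq.le).1 (hpS.trans_le (hST.trans_eq hqT.symm))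
  · refine Filter.mem_of_superset
      (Ioi_mem_nhds (Phi2_pos_and_integral_eq hsupp hmean hS).1) fun p hp => ?_
    refine ⟨_, ?_, Phi2_integral_logb_one_add_mul hsupp hmean (le_of_lt hp)⟩
    simpa using hmono self_mem_Ici (Ioi_subset_Ici_self hp) hp

lemma hasDerivAt_Phi2 [IsFiniteMeasure μ] [NeZero μ] (hsupp : μ (Iic 0) = 0)
    (hmean : Integrable id μ) {S : ℝ} (hS : 0 < S) :
    HasDerivAt (Phi2 μ) (log 2 / ∫ g, g / (1 + g * Phi2 μ S) ∂μ) S := by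
  have hp := (Phi2_pos_and_integral_eq hsupp hmean hS).1
  have hpos : 0 < ∫ g, g / (1 + g * Phi2 μ S) ∂μ := by
    refine integral_pos_of_ae_pos ?_ (integrable_div_one_add_mul hsupp hmean hp.le)
    filter_upwards [ae_pos_of_measure_Iic_zero hsupp] with g hg
    positivity
  rw [← inv_div]
  refine (hasDerivAt_integral_logb_one_add_mul hsupp hmean hp).of_local_left_inverse
    (continuousAt_Phi2 hsupp hmean hS) (div_pos hpos (log_pos one_lt_two)).ne' ?_
  filter_upwards [Ioi_mem_nhds hS] with T hT
  exact (Phi2_pos_and_integral_eq hsupp hmean hT).2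

end Capacity

/-- For every `S > 0`, `p* = Φ₂(S)` is the unique `p ≥ 0` with
`∫ log₂(1 + g·p) dμ(g) = S`, `Φ₂` is differentiable at `S`, and
`Φ₂'(S) = ln 2 / ∫ g/(1 + g·p*) dμ(g)`.  Here `μ` is a probability measure on `(0,∞)`
with finite mean. -/
theorem stmt_19 (μ : Measure ℝ) [IsProbabilityMeasure μ]
    (hsupp : μ (Iic 0) = 0) (hmean : Integrable id μ) :
    ∀ S : ℝ, 0 < S →
      (0 ≤ Phi2 μ S ∧ ∫ g, logb 2 (1 + g * Phi2 μ S) ∂μ = S) ∧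
      (∀ p : ℝ, 0 ≤ p → (∫ g, logb 2 (1 + g * p) ∂μ) = S → p = Phi2 μ S) ∧
      HasDerivAt (Phi2 μ) (Real.log 2 / ∫ g, g / (1 + g * Phi2 μ S) ∂μ) S := by
  intro S hS
  obtain ⟨hpos, heq⟩ := Phi2_pos_and_integral_eq hsupp hmean hS
  refine ⟨⟨hpos.le, heq⟩, fun p hp hpS => ?_, hasDerivAt_Phi2 hsupp hmean hS⟩
  rw [← hpS, Phi2_integral_logb_one_add_mul hsupp hmean hp]
end
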